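/- Let ℋ be a Hilbert space and let 𝒲 : ℋ → [0,+∞] be weakly (sequentially) lower semicontinuous, with exactly two zeros e⁻ and e⁺, and with liminf_{‖v‖→∞} 𝒲(v) > 0. If inf_{V∈𝒜} 𝒥_ℝ(V) < +∞, then 𝒥_ℝ attains its minimum on 𝒜: there exists U ∈ 𝒜 with 𝒥_ℝ(U) = min_{V∈𝒜} 𝒥_ℝ(V), and moreover U(t) converges weakly to e⁺ as t → +∞ and weakly to e⁻ as t → −∞, and the equipartition relation ½‖U′(t)‖² = 𝒲(U(t)) holds for almost every t ∈ ℝ. -/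

import Mathlib

open MeasureTheory Filter
open scoped ENNReal RealInnerProductSpace

/-- `V` belongs to `H¹_loc(ℝ; H)` with (locally square-integrable) derivative `V'`:
`V` is locally absolutely continuous with a.e. derivative `V'`. -/
def IsH1loc {H : Type*} [NormedAddCommGroup H] [NormedSpace ℝ H]
    (V V' : ℝ → H) : Prop :=
  (∀ a b : ℝ, V b - V a = ∫ t in a..b, V' t) ∧
    MeasureTheory.LocallyIntegrable (fun t => ‖V' t‖ ^ 2) MeasureTheory.volume

/-- The action functional `𝒥_ℝ(V) = ∫_ℝ [½‖V'(t)‖² + 𝒲(V(t))] dt`. -/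
noncomputable def actJ {H : Type*} [NormedAddCommGroup H]
    (W : H → ℝ≥0∞) (V V' : ℝ → H) : ℝ≥0∞ :=
  ∫⁻ t, (ENNReal.ofReal (‖V' t‖ ^ 2 / 2) + W (V t))

/-- Membership in the constrained class `𝒜` (the geometric constraint). -/
def memA {H : Type*} [NormedAddCommGroup H] [InnerProductSpace ℝ H]
    (em ep : H) (V : ℝ → H) : Prop :=
  ∃ tm tp : ℝ, tm < tp ∧
    (∀ t ≤ tm, ⟪V t - em, (‖ep - em‖)⁻¹ • (ep - em)⟫ ≤ 3 * ‖ep - em‖ / 4) ∧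
    (∀ t, tp ≤ t → ‖ep - em‖ / 4 ≤ ⟪V t - em, (‖ep - em‖)⁻¹ • (ep - em)⟫)

/-- A sequence converging weakly to `w` when tested against every vector. -/
def WeakTendsto {E ι : Type*} [NormedAddCommGroup E] [InnerProductSpace ℝ E]
    (v : ι → E) (l : Filter ι) (w : E) : Prop :=
  ∀ g : E, Tendsto (fun k => ⟪g, v k⟫) l (nhds ⟪g, w⟫)

/-- Bounded sequences of a Hilbert space have weakly convergent subsequences. -/
theorem exists_weakTendsto_subseq {E : Type*} [NormedAddCommGroup E] [InnerProductSpace ℝ E]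
    [CompleteSpace E] (v : ℕ → E) (C : ℝ) (hC : ∀ k, ‖v k‖ ≤ C) :
    ∃ (w : E) (φ : ℕ → ℕ), StrictMono φ ∧ WeakTendsto (v ∘ φ) atTop w := by
  set F : Submodule ℝ E := (Submodule.span ℝ (Set.range v)).topologicalClosure with hF
  have hvF : ∀ k, v k ∈ F := fun k =>
    Submodule.le_topologicalClosure _ (Submodule.subset_span ⟨k, rfl⟩)
  have hsep : TopologicalSpace.IsSeparable (F : Set E) := by
    rw [hF, Submodule.topologicalClosure_coe]
    exact ((Set.countable_range v).isSeparable.span (R := ℝ)).closure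
  have : TopologicalSpace.SeparableSpace F := hsep.separableSpace
  have : CompleteSpace F :=
    (Submodule.isClosed_topologicalClosure _).completeSpace_coe
  let u : ℕ → WeakDual ℝ F := fun k =>
    StrongDual.toWeakDual (InnerProductSpace.toDual ℝ F ⟨v k, hvF k⟩)
  have hu : ∀ k, u k ∈ WeakDual.toStrongDual ⁻¹' Metric.closedBall (0 : StrongDual ℝ F) C := by
    intro k
    have : ‖InnerProductSpace.toDual ℝ F ⟨v k, hvF k⟩‖ ≤ C := by
      rw [LinearIsometryEquiv.norm_map]; exact hC k
    exact mem_closedBall_zero_iff.2 this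
  obtain ⟨a, -, φ, hφ, ha⟩ := WeakDual.isSeqCompact_closedBall ℝ F 0 C hu
  refine ⟨((InnerProductSpace.toDual ℝ F).symm (WeakDual.toStrongDual a) : F), φ, hφ, fun g => ?_⟩
  have h1 := (WeakDual.eval_continuous (F.orthogonalProjectionOnto g)).tendsto a |>.comp ha
  have key : ∀ x : F, (⟪g, (x : E)⟫ : ℝ) = ⟪x, F.orthogonalProjectionOnto g⟫ := by
    intro x
    rw [real_inner_comm, Submodule.coe_inner,
      ← Submodule.inner_orthogonalProjectionOnto_eq_of_mem_left, Submodule.coe_inner]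
  convert h1 using 1
  · ext k
    exact key ⟨v (φ k), hvF _⟩
  · rw [key, InnerProductSpace.toDual_symm_apply]
    rfl

theorem WeakTendsto.comp {E ι κ : Type*} [NormedAddCommGroup E] [InnerProductSpace ℝ E]
    {v : ι → E} {l : Filter ι} {w : E} (h : WeakTendsto v l w) {φ : κ → ι} {l' : Filter κ}
    (hφ : Tendsto φ l' l) : WeakTendsto (v ∘ φ) l' w :=
  fun g => (h g).comp hφ

/-- Weak sequential lower semicontinuity. -/
def WeakSeqLSC {H : Type*} [NormedAddCommGroup H] [InnerProductSpace ℝ H] (W : H → ℝ≥0∞) : Prop :=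
  ∀ (v : ℕ → H) (w : H), WeakTendsto v atTop w → W w ≤ liminf (fun k => W (v k)) atTop

/-- The potential is bounded below by a positive constant outside of some ball. -/
def PosAtInfinity {H : Type*} [NormedAddCommGroup H] (W : H → ℝ≥0∞) : Prop :=
  ∃ ε : ℝ≥0∞, 0 < ε ∧ ∃ R : ℝ, ∀ v : H, R ≤ ‖v‖ → ε ≤ W v

/-- Weak sequential closedness. -/
def WeakSeqClosed {H : Type*} [NormedAddCommGroup H] [InnerProductSpace ℝ H] (K : Set H) : Prop :=
  ∀ (v : ℕ → H) (w : H), (∀ k, v k ∈ K) → WeakTendsto v atTop w → w ∈ K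

/-- A weakly sequentially lower semicontinuous coercive potential is bounded below by a positive
constant on any weakly sequentially closed set free of zeros. -/
theorem exists_pos_le_of_weakly_closed {H : Type*} [NormedAddCommGroup H] [InnerProductSpace ℝ H]
    [CompleteSpace H] {W : H → ℝ≥0∞} (hlsc : WeakSeqLSC W) (hcoer : PosAtInfinity W)
    {K : Set H} (hK : WeakSeqClosed K)
    (hK0 : ∀ v ∈ K, W v ≠ 0) :
    ∃ c : ℝ, 0 < c ∧ ∀ v ∈ K, ENNReal.ofReal c ≤ W v := by
  by_contra! hcon
  have hpos : ∀ k : ℕ, (0 : ℝ) < 1 / ((k : ℝ) + 1) := fun k => by positivity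
  choose v hvK hvW using fun k : ℕ => hcon _ (hpos k)
  obtain ⟨ε, hε, R, hR⟩ := hcoer
  have hlim : Tendsto (fun k : ℕ => ENNReal.ofReal (1 / ((k : ℝ) + 1))) atTop (nhds 0) := by
    have := ENNReal.tendsto_ofReal (tendsto_one_div_add_atTop_nhds_zero_nat (𝕜 := ℝ))
    simpa using this
  have hW0 : Tendsto (fun k => W (v k)) atTop (nhds 0) :=
    tendsto_of_tendsto_of_tendsto_of_le_of_le tendsto_const_nhds hlim
      (fun k => zero_le) fun k => (hvW k).le
  obtain ⟨N, hN⟩ := eventually_atTop.1 (hW0.eventually (gt_mem_nhds hε))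
  obtain ⟨w, φ, hφ, hw⟩ := exists_weakTendsto_subseq (fun k => v (k + N)) R fun k => by
    by_contra! h
    exact absurd (hR _ h.le) (not_le.2 (hN _ (Nat.le_add_left _ _)))
  have hle := hlsc _ w hw
  have h0 : Tendsto (fun k => W (((fun k => v (k + N)) ∘ φ) k)) atTop (nhds 0) :=
    hW0.comp ((tendsto_add_atTop_nat N).comp hφ.tendsto_atTop)
  rw [h0.liminf_eq] at hle
  exact hK0 w (hK _ w (fun k => hvK _) hw) (nonpos_iff_eq_zero.1 hle)

/-- The potential along a continuous curve is measurable. -/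
theorem measurable_potential_comp {H : Type*} [NormedAddCommGroup H] [InnerProductSpace ℝ H]
    {W : H → ℝ≥0∞} (hlsc : WeakSeqLSC W)
    {V : ℝ → H} (hV : Continuous V) : Measurable fun t => W (V t) := by
  refine LowerSemicontinuous.measurable (lowerSemicontinuous_iff_isClosed_preimage.2 fun y => ?_)
  refine IsSeqClosed.isClosed fun x t hx ht => ?_
  have h1 : WeakTendsto (fun k => V (x k)) atTop (V t) := fun g =>
    ((continuous_const.inner hV).tendsto t).comp ht
  refine (hlsc _ _ h1).trans ((liminf_le_liminf (Eventually.of_forall hx)).trans ?_)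
  simp

/-- A curve whose derivative is globally square-integrable and whose action is at most `M`. -/
structure ActionLE {H : Type*} [NormedAddCommGroup H] [NormedSpace ℝ H]
    (W : H → ℝ≥0∞) (M : ℝ) (V V' : ℝ → H) : Prop where
  ftc : ∀ a b : ℝ, V b - V a = ∫ t in a..b, V' t
  memLp : MemLp V' 2 volume
  le : actJ W V V' ≤ ENNReal.ofReal M

/-- The action of a curve over a set of times. -/
noncomputable def actOn {H : Type*} [NormedAddCommGroup H]
    (W : H → ℝ≥0∞) (V V' : ℝ → H) (s : Set ℝ) : ℝ≥0∞ :=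
  ∫⁻ t in s, (ENNReal.ofReal (‖V' t‖ ^ 2 / 2) + W (V t))

section Curves

variable {H : Type*} [NormedAddCommGroup H] {W : H → ℝ≥0∞}
  {M : ℝ} {V V' : ℝ → H}

theorem actOn_mono {s t : Set ℝ} (h : s ⊆ t) : actOn W V V' s ≤ actOn W V V' t :=
  lintegral_mono_set h

theorem actOn_le_actJ (s : Set ℝ) : actOn W V V' s ≤ actJ W V V' :=
  setLIntegral_le_lintegral _ _

theorem ofReal_mul_sub_le_actOn {c a b : ℝ} (hc : 0 ≤ c)
    (hW : ∀ t ∈ Set.Ioc a b, ENNReal.ofReal c ≤ W (V t)) :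
    ENNReal.ofReal (c * (b - a)) ≤ actOn W V V' (Set.Ioc a b) := by
  rw [ENNReal.ofReal_mul hc, ← Real.volume_Ioc, ← setLIntegral_const]
  exact setLIntegral_mono' measurableSet_Ioc fun t ht => (hW t ht).trans le_add_self

/-- The tail of a finite action tends to zero. -/
theorem exists_actOn_Ioi_lt (h : actJ W V V' ≠ ⊤) {η : ℝ≥0∞} (hη : 0 < η) :
    ∃ T : ℝ, ∀ t, T ≤ t → actOn W V V' (Set.Ioi t) < η := by
  have hlim : Tendsto (fun n : ℕ => actOn W V V' (Set.Ioi (n : ℝ))) atTop (nhds 0) := by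
    set μ : Measure ℝ :=
      volume.withDensity fun t => ENNReal.ofReal (‖V' t‖ ^ 2 / 2) + W (V t) with hμ
    have hfin : μ Set.univ ≠ ⊤ := by
      rw [hμ, withDensity_apply _ MeasurableSet.univ, Measure.restrict_univ]; exact h
    have := tendsto_measure_iInter_atTop (μ := μ) (s := fun n : ℕ => Set.Ioi (n : ℝ))
      (fun n => measurableSet_Ioi.nullMeasurableSet)
      (fun m n hmn => Set.Ioi_subset_Ioi (by exact_mod_cast hmn))
      ⟨0, ne_top_of_le_ne_top hfin (measure_mono (Set.subset_univ _))⟩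
    have hempty : ⋂ n : ℕ, Set.Ioi (n : ℝ) = ∅ := by
      ext x
      simp only [Set.mem_iInter, Set.mem_Ioi, Set.mem_empty_iff_false, iff_false, not_forall,
        not_lt]
      exact exists_nat_ge x
    rw [hempty, measure_empty] at this
    refine this.congr fun n => ?_
    rw [Function.comp_apply, hμ, withDensity_apply _ measurableSet_Ioi, actOn]
  obtain ⟨n, hn⟩ := (hlim.eventually (gt_mem_nhds hη)).exists
  exact ⟨n, fun t ht => (actOn_mono (Set.Ioi_subset_Ioi ht)).trans_lt hn⟩

variable [NormedSpace ℝ H]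

theorem ActionLE.intervalIntegrable (h : ActionLE W M V V') (a b : ℝ) :
    IntervalIntegrable V' volume a b :=
  ((h.memLp.locallyIntegrable (by norm_num)).integrableOn_isCompact
    isCompact_uIcc).intervalIntegrable

theorem ActionLE.isH1loc (h : ActionLE W M V V') : IsH1loc V V' :=
  ⟨h.ftc, h.memLp.integrable_norm_pow (by norm_num) |>.locallyIntegrable⟩

theorem ActionLE.continuous (h : ActionLE W M V V') : Continuous V := by
  have : V = fun b => V 0 + ∫ t in (0 : ℝ)..b, V' t := by
    ext b; rw [← h.ftc]; abel
  rw [this]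
  exact continuous_const.add
    (intervalIntegral.continuous_primitive (fun a b => h.intervalIntegrable a b) 0)

theorem ofReal_mul_enorm_sub_le (hftc : ∀ a b : ℝ, V b - V a = ∫ t in a..b, V' t)
    {r a b : ℝ} (hr : 0 ≤ r) (hab : a ≤ b) :
    ENNReal.ofReal (r * ‖V b - V a‖) ≤
      ∫⁻ t in Set.Ioc a b, (ENNReal.ofReal (‖V' t‖ ^ 2 / 2) + ENNReal.ofReal (r ^ 2 / 2)) := by
  rw [ENNReal.ofReal_mul hr, ofReal_norm, hftc, intervalIntegral.integral_of_le hab]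
  refine (mul_le_mul_right (enorm_integral_le_lintegral_enorm _) _).trans ?_
  rw [← lintegral_const_mul' _ _ ENNReal.ofReal_ne_top]
  refine lintegral_mono fun t => ?_
  rw [← ofReal_norm, ← ENNReal.ofReal_mul hr, ← ENNReal.ofReal_add (by positivity) (by positivity)]
  exact ENNReal.ofReal_le_ofReal (by nlinarith [sq_nonneg (‖V' t‖ - r)])

/-- Curves of action at most `M` satisfy a common modulus of continuity. -/
theorem ActionLE.mul_norm_sub_le (h : ActionLE W M V V') (hM : 0 ≤ M) {r a b : ℝ} (hr : 0 ≤ r)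
    (hab : a ≤ b) : r * ‖V b - V a‖ ≤ M + r ^ 2 / 2 * (b - a) := by
  have h1 := ofReal_mul_enorm_sub_le h.ftc hr hab
  rw [lintegral_add_right _ measurable_const, setLIntegral_const, Real.volume_Ioc,
    ← ENNReal.ofReal_mul (by positivity)] at h1
  have h2 : ∫⁻ t in Set.Ioc a b, ENNReal.ofReal (‖V' t‖ ^ 2 / 2) ≤ ENNReal.ofReal M :=
    (setLIntegral_le_lintegral _ _).trans ((lintegral_mono fun t => le_self_add).trans h.le)
  have h3 := h1.trans (add_le_add_left h2 _)
  have hba : 0 ≤ b - a := sub_nonneg.2 hab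
  rw [← ENNReal.ofReal_add hM (by positivity)] at h3
  exact (ENNReal.ofReal_le_ofReal_iff (by positivity)).1 h3

theorem exists_uniform_modulus (hM : 0 ≤ M) {ε : ℝ} (hε : 0 < ε) :
    ∃ δ : ℝ, 0 < δ ∧ ∀ V V' : ℝ → H, ActionLE W M V V' → ∀ a b : ℝ, |b - a| ≤ δ →
      ‖V b - V a‖ ≤ ε := by
  set r : ℝ := 2 * (M + 1) / ε with hr
  have hr0 : 0 < r := by positivity
  refine ⟨ε / r, by positivity, fun V V' h => ?_⟩
  have key : ∀ a b : ℝ, a ≤ b → |b - a| ≤ ε / r → ‖V b - V a‖ ≤ ε := by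
    intro a b hab hd
    rw [abs_of_nonneg (sub_nonneg.2 hab)] at hd
    have h1 := h.mul_norm_sub_le hM hr0.le hab
    have h2 : r ^ 2 / 2 * (b - a) ≤ r * ε / 2 := by
      calc r ^ 2 / 2 * (b - a) ≤ r ^ 2 / 2 * (ε / r) := by gcongr
        _ = r * ε / 2 := by field_simp
    have h3 : r * ε = 2 * (M + 1) := by rw [hr]; field_simp
    refine le_of_mul_le_mul_left (?_ : r * _ ≤ r * ε) hr0
    linarith
  intro a b hd
  rcases le_total a b with hab | hab
  · exact key a b hab hd
  · rw [norm_sub_rev]; exact key b a hab (by rwa [abs_sub_comm])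

/-- Crossing a region where the potential is bounded below costs action. -/
theorem ofReal_mul_norm_sub_le_actOn (hftc : ∀ a b : ℝ, V b - V a = ∫ t in a..b, V' t)
    {r a b : ℝ} (hr : 0 ≤ r) (hab : a ≤ b)
    (hW : ∀ t ∈ Set.Ioo a b, ENNReal.ofReal (r ^ 2 / 2) ≤ W (V t)) :
    ENNReal.ofReal (r * ‖V b - V a‖) ≤ actOn W V V' (Set.Ioc a b) := by
  refine (ofReal_mul_enorm_sub_le hftc hr hab).trans ?_
  rw [actOn, ← restrict_Ioo_eq_restrict_Ioc]
  exact setLIntegral_mono' measurableSet_Ioo fun t ht => add_le_add_right (hW t ht) _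

theorem ActionLE.comp_add (h : ActionLE W M V V') (p : ℝ) :
    ActionLE W M (fun t => V (t + p)) (fun t => V' (t + p)) := by
  refine ⟨fun a b => ?_, h.memLp.comp_measurePreserving (measurePreserving_add_right volume p), ?_⟩
  · rw [intervalIntegral.integral_comp_add_right, h.ftc]
  · refine (le_of_eq ?_).trans h.le
    exact lintegral_add_right_eq_self
      (fun t => ENNReal.ofReal (‖V' t‖ ^ 2 / 2) + W (V t)) p

theorem ActionLE.comp_neg (h : ActionLE W M V V') :
    ActionLE W M (fun t => V (-t)) (fun t => -V' (-t)) := by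
  refine ⟨fun a b => ?_,
    (h.memLp.comp_measurePreserving (Measure.measurePreserving_neg volume)).neg, ?_⟩
  · rw [intervalIntegral.integral_neg, intervalIntegral.integral_comp_neg, h.ftc,
      intervalIntegral.integral_symm]
  · refine (le_of_eq ?_).trans h.le
    simp only [actJ, norm_neg]
    exact lintegral_neg_eq_self (fun t => ENNReal.ofReal (‖V' t‖ ^ 2 / 2) + W (V t))

end Curves

/-- A continuous function descending from `β` to `α` does so on a subinterval inside which it
takes only intermediate values. -/
theorem exists_crossing {g : ℝ → ℝ} (hg : Continuous g) {a b α β : ℝ} (hab : a ≤ b)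
    (ha : β ≤ g a) (hb : g b ≤ α) :
    ∃ a' b', a ≤ a' ∧ a' ≤ b' ∧ b' ≤ b ∧ β ≤ g a' ∧ g b' ≤ α ∧
      ∀ t ∈ Set.Ioo a' b', g t ∈ Set.Icc α β := by
  obtain ⟨b', ⟨⟨hb'1, hb'2⟩, hb'3⟩, hb'min⟩ :=
    (isCompact_Icc.inter_right (isClosed_le hg continuous_const) :
      IsCompact (Set.Icc a b ∩ {t | g t ≤ α})).exists_isLeast ⟨b, ⟨hab, le_rfl⟩, hb⟩
  obtain ⟨a', ⟨⟨ha'1, ha'2⟩, ha'3⟩, ha'max⟩ :=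
    (isCompact_Icc.inter_right (isClosed_le continuous_const hg) :
      IsCompact (Set.Icc a b' ∩ {t | β ≤ g t})).exists_isGreatest ⟨a, ⟨le_rfl, hb'1⟩, ha⟩
  refine ⟨a', b', ha'1, ha'2, hb'2, ha'3, hb'3, fun t ht => ⟨?_, ?_⟩⟩
  · by_contra! h
    exact absurd (hb'min ⟨⟨ha'1.trans ht.1.le, ht.2.le.trans hb'2⟩, h.le⟩) (not_le.2 ht.2)
  · by_contra! h
    exact absurd (ha'max ⟨⟨ha'1.trans ht.1.le, ht.2.le⟩, h.le⟩) (not_le.2 ht.1)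

theorem WeakSeqClosed.inter {H : Type*} [NormedAddCommGroup H] [InnerProductSpace ℝ H]
    {K L : Set H} (hK : WeakSeqClosed K) (hL : WeakSeqClosed L) : WeakSeqClosed (K ∩ L) :=
  fun v w hv hw => ⟨hK v w (fun k => (hv k).1) hw, hL v w (fun k => (hv k).2) hw⟩

/-- Preimages of closed sets under affine functionals are weakly sequentially closed. -/
theorem weakSeqClosed_preimage_inner {H : Type*} [NormedAddCommGroup H] [InnerProductSpace ℝ H]
    (g e : H) {S : Set ℝ} (hS : IsClosed S) : WeakSeqClosed {v : H | ⟪g, v - e⟫ ∈ S} := by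
  intro v w hv hw
  have h : Tendsto (fun k => ⟪g, v k - e⟫) atTop (nhds ⟪g, w - e⟫) := by
    simp only [inner_sub_right]
    exact (hw g).sub_const _
  exact hS.mem_of_tendsto h (Eventually.of_forall hv)

theorem WeakTendsto.le_liminf_ofReal_norm_sq {E : Type*} [NormedAddCommGroup E]
    [InnerProductSpace ℝ E] {v : ℕ → E} {w : E} (h : WeakTendsto v atTop w) :
    ENNReal.ofReal (‖w‖ ^ 2 / 2) ≤ liminf (fun k => ENNReal.ofReal (‖v k‖ ^ 2 / 2)) atTop := by
  have h1 : Tendsto (fun k => ⟪w, v k⟫ - ‖w‖ ^ 2 / 2) atTop (nhds (‖w‖ ^ 2 / 2)) := by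
    have := (h w).sub_const (‖w‖ ^ 2 / 2)
    rw [real_inner_self_eq_norm_sq] at this
    convert this using 2; ring
  rw [← (ENNReal.tendsto_ofReal h1).liminf_eq]
  refine liminf_le_liminf (Eventually.of_forall fun k => ENNReal.ofReal_le_ofReal ?_)
  nlinarith [real_inner_le_norm w (v k), sq_nonneg (‖w‖ - ‖v k‖)]

theorem ENNReal.liminf_add_liminf_le (u v : ℕ → ℝ≥0∞) :
    liminf u atTop + liminf v atTop ≤ liminf (fun k => u k + v k) atTop := by
  simp only [liminf_eq_iSup_iInf_of_nat']
  rw [ENNReal.iSup_add_iSup]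
  · exact iSup_mono fun n => le_iInf fun i => add_le_add (iInf_le _ i) (iInf_le _ i)
  · refine fun m n => ⟨max m n, add_le_add ?_ ?_⟩ <;> refine le_iInf fun i => ?_
    · exact (iInf_le _ (i + (max m n - m))).trans_eq (by congr 1; omega)
    · exact (iInf_le _ (i + (max m n - n))).trans_eq (by congr 1; omega)

section Limits

variable {H : Type*} [NormedAddCommGroup H] [InnerProductSpace ℝ H]
  {W : H → ℝ≥0∞} {M : ℝ}

theorem lintegral_kinetic_eq {f : ℝ → H} (hf : MemLp f 2 volume) :
    ∫⁻ t, ENNReal.ofReal (‖f t‖ ^ 2 / 2) = ENNReal.ofReal (‖hf.toLp f‖ ^ 2 / 2) := by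
  have hint : Integrable (fun t => ‖f t‖ ^ 2) volume := hf.integrable_norm_pow (by norm_num)
  have h1 : ‖hf.toLp f‖ ^ 2 = ∫ t, ‖f t‖ ^ 2 := by
    rw [← real_inner_self_eq_norm_sq, L2.inner_def]
    refine integral_congr_ae ?_
    filter_upwards [hf.coeFn_toLp] with t ht
    rw [ht, real_inner_self_eq_norm_sq]
  rw [h1, ← integral_div, ofReal_integral_eq_lintegral_ofReal (hint.div_const 2)]
  exact Eventually.of_forall fun t => by positivity

theorem ActionLE.exists_norm_bound (hcoer : PosAtInfinity W) (hM : 0 ≤ M) :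
    ∃ B : ℝ, ∀ V V' : ℝ → H, ActionLE W M V V' → ‖V 0‖ ≤ B := by
  obtain ⟨ε, hε, R, hR⟩ := hcoer
  obtain ⟨c, -, hc0, hcε⟩ := ENNReal.lt_iff_exists_real_btwn.1 hε
  have hc : 0 < c := ENNReal.ofReal_pos.1 hc0
  set T : ℝ := (M + 1) / c with hT
  have hT0 : 0 < T := by positivity
  refine ⟨R + M + T / 2, fun V V' h => ?_⟩
  obtain ⟨t, ht, htR⟩ : ∃ t ∈ Set.Ioc 0 T, ‖V t‖ ≤ R := by
    by_contra! hcon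
    have h1 := (ofReal_mul_sub_le_actOn (W := W) (V' := V') hc.le fun t ht =>
      hcε.le.trans (hR _ (hcon t ht).le)).trans ((actOn_le_actJ _).trans h.le)
    have h2 := (ENNReal.ofReal_le_ofReal_iff hM).1 h1
    have h3 : c * (T - 0) = M + 1 := by rw [hT]; field_simp; ring
    linarith
  have h1 := h.mul_norm_sub_le hM zero_le_one ht.1.le
  have h2 : ‖V 0‖ ≤ ‖V t‖ + ‖V t - V 0‖ := by
    have := norm_sub_norm_le (V 0) (V t)
    rw [norm_sub_rev] at this
    linarith
  have := ht.2
  linarith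

variable [CompleteSpace H]

/-- A curve of finite action eventually confined to a weakly closed set containing at most one
zero of the potential converges weakly to that zero. -/
theorem ActionLE.weakTendsto_atTop (hlsc : WeakSeqLSC W) (hcoer : PosAtInfinity W) {V V' : ℝ → H}
    (h : ActionLE W M V V') (hM : 0 ≤ M) {e : H} {C : Set H} (hC : WeakSeqClosed C)
    (hCe : ∀ v ∈ C, W v = 0 → v = e) {t₀ : ℝ} (hVC : ∀ t, t₀ ≤ t → V t ∈ C) :
    WeakTendsto V atTop e := by
  intro g
  rw [Metric.tendsto_atTop]
  intro ε hε
  obtain ⟨δ, hδ, hmod⟩ := exists_uniform_modulus (W := W) (H := H) hM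
    (ε := ε / (2 * (‖g‖ + 1))) (by positivity)
  have hclosed : IsClosed {x : ℝ | ε / 2 ≤ |x|} := isClosed_le continuous_const continuous_abs
  obtain ⟨c, hc, hcW⟩ := exists_pos_le_of_weakly_closed hlsc hcoer
    (hC.inter (weakSeqClosed_preimage_inner g e hclosed)) (by
      rintro v ⟨hv, hv'⟩ h0
      rw [hCe v hv h0] at hv'
      simp only [Set.mem_ofPred_eq, sub_self, inner_zero_right, abs_zero] at hv'
      linarith)
  obtain ⟨T, hT⟩ := exists_actOn_Ioi_lt (ne_top_of_le_ne_top ENNReal.ofReal_ne_top h.le)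
    (η := ENNReal.ofReal (c * δ)) (ENNReal.ofReal_pos.2 (by positivity))
  refine ⟨max T t₀, fun t ht => ?_⟩
  rw [Real.dist_eq, ← inner_sub_right]
  by_contra! hcon
  have hlow : ENNReal.ofReal (c * (t + δ - t)) ≤ actOn W V V' (Set.Ioc t (t + δ)) := by
    refine ofReal_mul_sub_le_actOn hc.le fun s hs => hcW _
      ⟨hVC s ((le_max_right _ _).trans (ht.trans hs.1.le)), ?_⟩
    have h1 : ‖V s - V t‖ ≤ ε / (2 * (‖g‖ + 1)) :=
      hmod V V' h t s (by rw [abs_of_nonneg] <;> linarith [hs.1, hs.2])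
    have h2 : |⟪g, V s - V t⟫| ≤ ε / 2 := by
      calc |⟪g, V s - V t⟫| ≤ ‖g‖ * ‖V s - V t‖ := abs_real_inner_le_norm _ _
        _ ≤ (‖g‖ + 1) * (ε / (2 * (‖g‖ + 1))) := by gcongr; linarith
        _ = ε / 2 := by field_simp
    have h3 : ⟪g, V t - e⟫ = ⟪g, V s - e⟫ - ⟪g, V s - V t⟫ := by
      rw [← inner_sub_right]; congr 1; abel
    have h4 := abs_sub (⟪g, V s - e⟫ : ℝ) ⟪g, V s - V t⟫
    rw [h3] at hcon
    simp only [Set.mem_ofPred_eq]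
    linarith
  rw [add_sub_cancel_left] at hlow
  exact absurd (hT t ((le_max_left _ _).trans ht))
    (not_lt.2 (hlow.trans (actOn_mono Set.Ioc_subset_Ioi_self)))

/-- Weak compactness and lower semicontinuity for sequences of curves of bounded action. -/
theorem exists_limit_curve (hlsc : WeakSeqLSC W) (hcoer : PosAtInfinity W) (hM : 0 ≤ M)
    {V V' : ℕ → ℝ → H} (h : ∀ k, ActionLE W M (V k) (V' k)) :
    ∃ (U U' : ℝ → H) (φ : ℕ → ℕ), StrictMono φ ∧
      (∀ a b : ℝ, U b - U a = ∫ t in a..b, U' t) ∧ MemLp U' 2 volume ∧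
      (∀ t, WeakTendsto (fun k => V (φ k) t) atTop (U t)) ∧
      actJ W U U' ≤ liminf (fun k => actJ W (V (φ k)) (V' (φ k))) atTop := by
  obtain ⟨B, hB⟩ := ActionLE.exists_norm_bound (H := H) hcoer hM
  have hkin : ∀ k, ‖(h k).memLp.toLp (V' k)‖ ≤ 2 * M + 1 := by
    intro k
    have h1 : ENNReal.ofReal (‖(h k).memLp.toLp (V' k)‖ ^ 2 / 2) ≤ ENNReal.ofReal M := by
      rw [← lintegral_kinetic_eq]
      exact (lintegral_mono fun t => le_self_add).trans (h k).le
    have h2 := (ENNReal.ofReal_le_ofReal_iff hM).1 h1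
    nlinarith [sq_nonneg (‖(h k).memLp.toLp (V' k)‖ - 1)]
  obtain ⟨u₀, φ₁, hφ₁, hu₀⟩ := exists_weakTendsto_subseq (fun k => V k 0) B
    fun k => hB _ _ (h k)
  obtain ⟨u', φ₂, hφ₂, hu'⟩ := exists_weakTendsto_subseq
    (fun k => (h (φ₁ k)).memLp.toLp (V' (φ₁ k))) (2 * M + 1) fun k => hkin _
  set φ := φ₁ ∘ φ₂ with hφ
  have hint : ∀ a b : ℝ, IntervalIntegrable u' volume a b := fun a b =>
    (((Lp.memLp u').locallyIntegrable (by norm_num)).integrableOn_isCompact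
      isCompact_uIcc).intervalIntegrable
  have hftc : ∀ a b : ℝ, (u₀ + ∫ t in (0 : ℝ)..b, u' t) - (u₀ + ∫ t in (0 : ℝ)..a, u' t) =
      ∫ t in a..b, u' t := by
    intro a b
    rw [add_sub_add_left_eq_sub, intervalIntegral.integral_interval_sub_left (hint _ _) (hint _ _)]
  have hIoc : ∀ a b : ℝ, ∀ g : H, Tendsto (fun k => ⟪g, ∫ t in Set.Ioc a b, V' (φ k) t⟫) atTop
      (nhds ⟪g, ∫ t in Set.Ioc a b, u' t⟫) := by
    intro a b g
    have h1 := hu' (indicatorConstLp 2 (measurableSet_Ioc (a := a) (b := b))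
      (measure_Ioc_lt_top (μ := volume)).ne g)
    simp only [L2.inner_indicatorConstLp_eq_inner_setIntegral] at h1
    refine h1.congr fun k => ?_
    congr 1
    refine integral_congr_ae (ae_restrict_of_ae ?_)
    exact (h (φ k)).memLp.coeFn_toLp
  have hlim : ∀ t, WeakTendsto (fun k => V (φ k) t) atTop (u₀ + ∫ s in (0 : ℝ)..t, u' s) := by
    intro t g
    have h0 : Tendsto (fun k => ⟪g, V (φ k) 0⟫) atTop (nhds ⟪g, u₀⟫) :=
      (hu₀ g).comp hφ₂.tendsto_atTop
    have h1 : Tendsto (fun k => ⟪g, ∫ s in (0 : ℝ)..t, V' (φ k) s⟫) atTop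
        (nhds ⟪g, ∫ s in (0 : ℝ)..t, u' s⟫) := by
      simp only [intervalIntegral, inner_sub_right]
      exact (hIoc 0 t g).sub (hIoc t 0 g)
    rw [inner_add_right]
    refine (h0.add h1).congr fun k => ?_
    rw [← inner_add_right, ← (h (φ k)).ftc]
    congr 1; abel
  refine ⟨_, u', φ, hφ₁.comp hφ₂, hftc, Lp.memLp u', hlim, ?_⟩
  have hmeas : ∀ k, Measurable fun t => W (V (φ k) t) := fun k =>
    measurable_potential_comp hlsc (h (φ k)).continuous
  have hcont : Continuous fun t => u₀ + ∫ s in (0 : ℝ)..t, u' s :=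
    continuous_const.add (intervalIntegral.continuous_primitive hint 0)
  have hpot : ∫⁻ t, W (u₀ + ∫ s in (0 : ℝ)..t, u' s) ≤
      liminf (fun k => ∫⁻ t, W (V (φ k) t)) atTop :=
    (lintegral_mono fun t => hlsc _ _ (hlim t)).trans (lintegral_liminf_le hmeas)
  have hkinlim : ∫⁻ t, ENNReal.ofReal (‖u' t‖ ^ 2 / 2) ≤
      liminf (fun k => ∫⁻ t, ENNReal.ofReal (‖V' (φ k) t‖ ^ 2 / 2)) atTop := by
    rw [lintegral_kinetic_eq (Lp.memLp u'), Lp.toLp_coeFn]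
    refine hu'.le_liminf_ofReal_norm_sq.trans (le_of_eq ?_)
    congr 1
    ext k
    exact (lintegral_kinetic_eq (h (φ k)).memLp).symm
  have hsum : ∀ V V' : ℝ → H, Measurable (fun t => W (V t)) → actJ W V V' =
      (∫⁻ t, ENNReal.ofReal (‖V' t‖ ^ 2 / 2)) + ∫⁻ t, W (V t) := fun V V' hV =>
    lintegral_add_right _ hV
  rw [hsum _ _ (measurable_potential_comp hlsc hcont)]
  refine (add_le_add hkinlim hpot).trans ((ENNReal.liminf_add_liminf_le _ _).trans (le_of_eq ?_))
  congr 1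
  ext k
  exact (hsum _ _ (hmeas k)).symm

end Limits

/-- The coordinate of a point along the segment from `em` to `ep`. -/
noncomputable def height {H : Type*} [NormedAddCommGroup H] [InnerProductSpace ℝ H]
    (em ep v : H) : ℝ :=
  ⟪v - em, (‖ep - em‖)⁻¹ • (ep - em)⟫

section Height

variable {H : Type*} [NormedAddCommGroup H] [InnerProductSpace ℝ H] {em ep : H}

theorem height_left : height em ep em = 0 := by simp [height]

theorem height_right (hne : em ≠ ep) : height em ep ep = ‖ep - em‖ := by
  have : ‖ep - em‖ ≠ 0 := norm_ne_zero_iff.2 (sub_ne_zero.2 hne.symm)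
  rw [height, real_inner_smul_right, real_inner_self_eq_norm_sq]
  field_simp

theorem height_sub (v w : H) :
    height em ep v - height em ep w = ⟪v - w, (‖ep - em‖)⁻¹ • (ep - em)⟫ := by
  rw [height, height, ← inner_sub_left, sub_sub_sub_cancel_right]

theorem abs_height_sub_le (v w : H) : |height em ep v - height em ep w| ≤ ‖v - w‖ := by
  rw [height_sub]
  refine (abs_real_inner_le_norm _ _).trans ?_
  refine mul_le_of_le_one_right (norm_nonneg _) ?_
  rw [norm_smul, norm_inv, norm_norm]
  exact inv_mul_le_one

theorem continuous_height : Continuous (height em ep) := by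
  unfold height; fun_prop

theorem WeakTendsto.height {ι : Type*} {v : ι → H} {l : Filter ι} {w : H}
    (h : WeakTendsto v l w) :
    Tendsto (fun k => _root_.height em ep (v k)) l (nhds (_root_.height em ep w)) := by
  simp only [_root_.height, inner_sub_left, real_inner_comm _ (v _), real_inner_comm _ w]
  simpa only [real_inner_comm] using (h ((‖ep - em‖)⁻¹ • (ep - em))).sub_const _

theorem weakSeqClosed_height {S : Set ℝ} (hS : IsClosed S) :
    WeakSeqClosed {v : H | height em ep v ∈ S} := fun _ _ hv hw =>
  hS.mem_of_tendsto hw.height (Eventually.of_forall hv)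

variable {W : H → ℝ≥0∞} {M : ℝ}

/-- Under the constraint, every admissible curve of finite action has a genuinely measurable
derivative: otherwise it would take the same zero of the potential near both ends. -/
theorem IsH1loc.actionLE (hne : em ≠ ep) (hzeros : ∀ v, W v = 0 ↔ v = em ∨ v = ep)
    {V V' : ℝ → H} (hV : IsH1loc V V') (hA : memA em ep V)
    (hJ : actJ W V V' ≤ ENNReal.ofReal M) : ActionLE W M V V' := by
  have hl : 0 < ‖ep - em‖ := norm_pos_iff.2 (sub_ne_zero.2 hne.symm)
  have hint : ∀ n : ℕ, IntervalIntegrable V' volume (-(n : ℝ)) n := by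
    by_contra! hcon
    obtain ⟨n, hn⟩ := hcon
    have hconst : ∀ a b : ℝ, a ≤ -(n : ℝ) → (n : ℝ) ≤ b → V b = V a := by
      intro a b ha hb
      have hn0 : (0 : ℝ) ≤ n := n.cast_nonneg
      rw [← sub_eq_zero, hV.1, intervalIntegral.integral_undef]
      refine fun h => hn (h.mono_set ?_)
      rw [Set.uIcc_of_le (by linarith), Set.uIcc_of_le (by linarith)]
      exact Set.Icc_subset_Icc ha hb
    set c := V (-(n : ℝ)) with hc
    have hright : ∀ b : ℝ, (n : ℝ) ≤ b → V b = c := fun b hb => hconst _ _ le_rfl hb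
    have hleft : ∀ a : ℝ, a ≤ -(n : ℝ) → V a = c := fun a ha => by
      rw [← hconst a n ha le_rfl, hright n le_rfl]
    have hWc : W c = 0 := by
      by_contra h0
      have h1 : ∫⁻ _ in Set.Ioi (n : ℝ), W c ≤ actJ W V V' := by
        refine le_trans ?_ (actOn_le_actJ (Set.Ioi (n : ℝ)))
        refine setLIntegral_mono' measurableSet_Ioi fun t ht => ?_
        rw [hright t (le_of_lt ht)]
        exact le_add_self
      rw [setLIntegral_const, Real.volume_Ioi, ENNReal.mul_top h0] at h1
      exact absurd (h1.trans hJ) (by simp)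
    obtain ⟨tm, tp, -, htm, htp⟩ := hA
    have h1 := htm (min tm (-(n : ℝ))) (min_le_left _ _)
    have h2 := htp (max tp n) (le_max_left _ _)
    rw [hleft _ (min_le_right _ _)] at h1
    rw [hright _ (le_max_right _ _)] at h2
    change height em ep c ≤ _ at h1
    change _ ≤ height em ep c at h2
    rcases (hzeros c).1 hWc with h | h
    · rw [h, height_left] at h2; linarith
    · rw [h, height_right hne] at h1; linarith
  have hmeas : AEStronglyMeasurable V' volume := by
    have h1 : AEStronglyMeasurable V'
        (volume.restrict (⋃ n : ℕ, Set.Ioc (-(n : ℝ)) n)) :=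
      AEStronglyMeasurable.iUnion fun n => (hint n).1.aestronglyMeasurable
    have h2 : ⋃ n : ℕ, Set.Ioc (-(n : ℝ)) n = Set.univ := by
      refine Set.eq_univ_of_forall fun x => Set.mem_iUnion.2 ?_
      obtain ⟨n, hn⟩ := exists_nat_gt |x|
      exact ⟨n, (abs_lt.1 hn).1, (abs_lt.1 hn).2.le⟩
    rwa [h2, Measure.restrict_univ] at h1
  refine ⟨hV.1, (memLp_two_iff_integrable_sq_norm hmeas).2 ?_, hJ⟩
  have h1 : Integrable (fun t => ‖V' t‖ ^ 2 / 2) volume := by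
    refine ⟨((hmeas.norm.aemeasurable.pow_const 2).div_const 2).aestronglyMeasurable, ?_⟩
    rw [hasFiniteIntegral_iff_ofReal (Eventually.of_forall fun t => by positivity)]
    exact ((lintegral_mono fun t => le_self_add).trans hJ).trans_lt ENNReal.ofReal_lt_top
  simpa using h1.mul_const 2

variable [CompleteSpace H]

theorem exists_crossing_cost (hlsc : WeakSeqLSC W) (hcoer : PosAtInfinity W) (hne : em ≠ ep)
    (hzeros : ∀ v, W v = 0 ↔ v = em ∨ v = ep) :
    ∃ c : ℝ, 0 < c ∧ ∀ V V' : ℝ → H, ActionLE W M V V' → ∀ a b : ℝ, a ≤ b →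
      3 * ‖ep - em‖ / 4 ≤ height em ep (V a) → height em ep (V b) ≤ ‖ep - em‖ / 2 →
      ENNReal.ofReal c ≤ actOn W V V' (Set.Ioc a b) := by
  have hl : 0 < ‖ep - em‖ := norm_pos_iff.2 (sub_ne_zero.2 hne.symm)
  obtain ⟨w, hw, hwW⟩ := exists_pos_le_of_weakly_closed hlsc hcoer
    (weakSeqClosed_height (em := em) (ep := ep)
      (isClosed_Icc (a := ‖ep - em‖ / 2) (b := 3 * ‖ep - em‖ / 4))) (by
      intro v hv h0
      rcases (hzeros v).1 h0 with h | h
      · rw [h, Set.mem_ofPred_eq, height_left] at hv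
        linarith [hv.1]
      · rw [h, Set.mem_ofPred_eq, height_right hne] at hv
        linarith [hv.2])
  refine ⟨√(2 * w) * (‖ep - em‖ / 4), by positivity, fun V V' h a b hab ha hb => ?_⟩
  obtain ⟨a', b', haa', hab', hb'b, ha', hb', hmid⟩ :=
    exists_crossing (continuous_height.comp h.continuous) hab ha hb
  have hr : √(2 * w) ^ 2 / 2 = w := by rw [Real.sq_sqrt (by positivity)]; ring
  have h1 := ofReal_mul_norm_sub_le_actOn (W := W) h.ftc (Real.sqrt_nonneg (2 * w)) hab'
    (fun t ht => by rw [hr]; exact hwW _ (hmid t ht))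
  refine le_trans (ENNReal.ofReal_le_ofReal ?_)
    (h1.trans (actOn_mono (Set.Ioc_subset_Ioc haa' hb'b)))
  refine mul_le_mul_of_nonneg_left ?_ (Real.sqrt_nonneg _)
  have h2 := (abs_le.1 (abs_height_sub_le (em := em) (ep := ep) (V b') (V a'))).1
  simp only [Function.comp_apply] at ha' hb'
  linarith

theorem ActionLE.weakTendsto_left_atTop (hlsc : WeakSeqLSC W) (hcoer : PosAtInfinity W)
    (hne : em ≠ ep) (hzeros : ∀ v, W v = 0 ↔ v = em ∨ v = ep) {V V' : ℝ → H}
    (h : ActionLE W M V V') (hM : 0 ≤ M) {t₀ : ℝ}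
    (hV : ∀ t, t₀ ≤ t → height em ep (V t) ≤ 3 * ‖ep - em‖ / 4) : WeakTendsto V atTop em := by
  have hl : 0 < ‖ep - em‖ := norm_pos_iff.2 (sub_ne_zero.2 hne.symm)
  refine h.weakTendsto_atTop hlsc hcoer hM
    (weakSeqClosed_height (em := em) (ep := ep) isClosed_Iic) (fun v hv h0 => ?_) hV
  refine ((hzeros v).1 h0).resolve_right fun h => ?_
  rw [h, Set.mem_ofPred_eq, height_right hne, Set.mem_Iic] at hv
  linarith

theorem ActionLE.weakTendsto_left_atBot (hlsc : WeakSeqLSC W) (hcoer : PosAtInfinity W)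
    (hne : em ≠ ep) (hzeros : ∀ v, W v = 0 ↔ v = em ∨ v = ep) {V V' : ℝ → H}
    (h : ActionLE W M V V') (hM : 0 ≤ M) {t₀ : ℝ}
    (hV : ∀ t, t ≤ t₀ → height em ep (V t) ≤ 3 * ‖ep - em‖ / 4) : WeakTendsto V atBot em := by
  have h1 := (h.comp_neg.weakTendsto_left_atTop hlsc hcoer hne hzeros hM (t₀ := -t₀)
    fun t ht => hV _ (by linarith)).comp tendsto_neg_atBot_atTop
  simpa [Function.comp_def] using h1

theorem ActionLE.weakTendsto_right_atTop (hlsc : WeakSeqLSC W) (hcoer : PosAtInfinity W)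
    (hne : em ≠ ep) (hzeros : ∀ v, W v = 0 ↔ v = em ∨ v = ep) {V V' : ℝ → H}
    (h : ActionLE W M V V') (hM : 0 ≤ M) {t₀ : ℝ}
    (hV : ∀ t, t₀ ≤ t → ‖ep - em‖ / 4 ≤ height em ep (V t)) : WeakTendsto V atTop ep := by
  have hl : 0 < ‖ep - em‖ := norm_pos_iff.2 (sub_ne_zero.2 hne.symm)
  refine h.weakTendsto_atTop hlsc hcoer hM
    (weakSeqClosed_height (em := em) (ep := ep) isClosed_Ici) (fun v hv h0 => ?_) hV
  refine ((hzeros v).1 h0).resolve_left fun h => ?_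
  rw [h, Set.mem_ofPred_eq, height_left, Set.mem_Ici] at hv
  linarith

end Height

section Extraction

variable {H : Type*} [NormedAddCommGroup H] [InnerProductSpace ℝ H] {em ep : H}
  {W : H → ℝ≥0∞} {M : ℝ}

/-- Upper bounds on the height of a pointwise weak limit are inherited, uniformly on compact
intervals and up to a small loss, by the approximating curves. -/
theorem eventually_forall_height_le (hM : 0 ≤ M) {V V' : ℕ → ℝ → H} {U : ℝ → H}
    (h : ∀ k, ActionLE W M (V k) (V' k))
    (hlim : ∀ t, WeakTendsto (fun k => V k t) atTop (U t)) {a b α β : ℝ} (hαβ : α < β)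
    (hU : ∀ t ∈ Set.Icc a b, height em ep (U t) ≤ α) :
    ∀ᶠ k in atTop, ∀ t ∈ Set.Icc a b, height em ep (V k t) ≤ β := by
  obtain ⟨δ, hδ, hmod⟩ := exists_uniform_modulus (W := W) (H := H) hM
    (ε := (β - α) / 2) (by linarith)
  have hloc : ∀ t ∈ Set.Icc a b, ∃ s ∈ nhdsWithin t (Set.Icc a b),
      ∀ᶠ k in atTop, ∀ t ∈ s, height em ep (V k t) ≤ β := by
    intro t ht
    refine ⟨Metric.closedBall t δ, nhdsWithin_le_nhds (Metric.closedBall_mem_nhds t hδ), ?_⟩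
    have h1 : ∀ᶠ k in atTop, height em ep (V k t) < (α + β) / 2 :=
      (hlim t).height.eventually (gt_mem_nhds (by linarith [hU t ht]))
    filter_upwards [h1] with k hk s hs
    have h2 := hmod _ _ (h k) t s (by simpa [Real.dist_eq] using hs)
    have h3 := (abs_le.1 ((abs_height_sub_le (em := em) (ep := ep) _ _).trans h2)).2
    linarith
  refine isCompact_Icc.induction_on (p := fun s => ∀ᶠ k in atTop, ∀ t ∈ s,
    height em ep (V k t) ≤ β) (by simp) (fun s t hst ht => ?_) (fun s t hs ht => ?_) hloc
  · filter_upwards [ht] with k hk x hx using hk x (hst hx)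
  · filter_upwards [hs, ht] with k hk hk' x hx using hx.elim (hk x) (hk' x)

variable [CompleteSpace H]

/-- A suitably translated subsequence of constrained curves of bounded action has a limit which
still satisfies the constraint. -/
theorem exists_constrained_limit (hlsc : WeakSeqLSC W) (hcoer : PosAtInfinity W) (hne : em ≠ ep)
    (hzeros : ∀ v, W v = 0 ↔ v = em ∨ v = ep) (hM : 0 ≤ M) {V V' : ℕ → ℝ → H}
    (h : ∀ k, ActionLE W M (V k) (V' k)) (hA : ∀ k, memA em ep (V k)) :
    ∃ (U U' : ℝ → H) (φ : ℕ → ℕ), StrictMono φ ∧ ActionLE W M U U' ∧ memA em ep U ∧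
      actJ W U U' ≤ liminf (fun k => actJ W (V (φ k)) (V' (φ k))) atTop := by
  have hl : 0 < ‖ep - em‖ := norm_pos_iff.2 (sub_ne_zero.2 hne.symm)
  obtain ⟨c, hc, hcross⟩ := exists_crossing_cost (M := M) hlsc hcoer hne hzeros
  let Q : ℕ → Prop := fun n => ∀ T : ℕ, ∃ᶠ k in atTop, ∃ s : ℝ,
    (∀ t ∈ Set.Icc (s - T) (s + T), height em ep (V k t) ≤ 3 * ‖ep - em‖ / 4) ∧
      ENNReal.ofReal (n * c) ≤ actOn W (V k) (V' k) (Set.Iic s)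
  have hQ0 : Q 0 := by
    refine fun T => Frequently.of_forall fun k => ?_
    obtain ⟨tm, tp, -, htm, -⟩ := hA k
    exact ⟨tm - T, fun t ht => htm t (by linarith [ht.2]), by simp⟩
  obtain ⟨n, hQn, hQn'⟩ : ∃ n, Q n ∧ ¬ Q (n + 1) := by
    by_contra! hcon
    have hall : ∀ n, Q n := fun n => Nat.rec hQ0 hcon n
    obtain ⟨n, hn⟩ := exists_nat_gt (M / c)
    obtain ⟨k, s, -, hs⟩ := (hall n 0).exists
    have h1 := (ENNReal.ofReal_le_ofReal_iff hM).1 (hs.trans ((actOn_le_actJ _).trans (h k).le))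
    rw [div_lt_iff₀ hc] at hn
    linarith
  obtain ⟨κ, hκ, hs⟩ := extraction_forall_of_frequently hQn
  choose s hslow hsact using hs
  have hp : ∀ j, ∃ p, s j ≤ p ∧ 3 * ‖ep - em‖ / 4 ≤ height em ep (V (κ j) p) ∧
      ∀ t, s j - j ≤ t → t < p → height em ep (V (κ j) t) ≤ 3 * ‖ep - em‖ / 4 := by
    intro j
    obtain ⟨tm, tp, -, -, htp⟩ := hA (κ j)
    have h1 := ((h (κ j)).weakTendsto_right_atTop hlsc hcoer hne hzeros hM htp).height
      (em := em) (ep := ep)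
    rw [height_right hne] at h1
    obtain ⟨b, hb1, hb2⟩ := ((h1.eventually (lt_mem_nhds
      (show 3 * ‖ep - em‖ / 4 < ‖ep - em‖ by linarith))).and (eventually_ge_atTop (s j))).exists
    obtain ⟨p, ⟨hp1, hp2⟩, hpmin⟩ := (isCompact_Icc.inter_right (isClosed_le continuous_const
      (continuous_height.comp (h (κ j)).continuous)) : IsCompact (Set.Icc (s j) b ∩
        {t | 3 * ‖ep - em‖ / 4 ≤ height em ep (V (κ j) t)})).exists_isLeast
      ⟨b, ⟨hb2, le_rfl⟩, hb1.le⟩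
    refine ⟨p, hp1.1, hp2, fun t ht htp => ?_⟩
    rcases le_total t (s j) with hts | hts
    · exact hslow j t ⟨ht, by linarith [(Nat.cast_nonneg j : (0 : ℝ) ≤ j)]⟩
    · by_contra! hcon
      exact absurd (hpmin ⟨⟨hts, htp.le.trans hp1.2⟩, hcon.le⟩) (not_le.2 htp)
  choose p hsp hpge hplow using hp
  have hX : ∀ j, ActionLE W M (fun t => V (κ j) (t + p j)) (fun t => V' (κ j) (t + p j)) :=
    fun j => (h (κ j)).comp_add (p j)
  obtain ⟨U, U', φ, hφ, hftc, hmem, hlim, hJ⟩ := exists_limit_curve hlsc hcoer hM hX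
  have hJ' : actJ W U U' ≤
      liminf (fun k => actJ W (V ((κ ∘ φ) k)) (V' ((κ ∘ φ) k))) atTop := by
    refine hJ.trans_eq ?_
    congr 1
    ext k
    exact lintegral_add_right_eq_self
      (fun t => ENNReal.ofReal (‖V' (κ (φ k)) t‖ ^ 2 / 2) + W (V (κ (φ k)) t)) _
  have hUM : ActionLE W M U U' := by
    refine ⟨hftc, hmem, hJ.trans ?_⟩
    refine (liminf_le_liminf (Eventually.of_forall fun k => (hX (φ k)).le)).trans ?_
    simp
  have hUneg : ∀ t, t < 0 → height em ep (U t) ≤ 3 * ‖ep - em‖ / 4 := by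
    intro t ht
    refine le_of_tendsto (hlim t).height ?_
    obtain ⟨N, hN⟩ := exists_nat_ge (-t)
    filter_upwards [eventually_ge_atTop N] with k hk
    have hk' : (N : ℝ) ≤ φ k := by exact_mod_cast hk.trans (hφ.id_le k)
    exact hplow (φ k) _ (by linarith [hsp (φ k)]) (by linarith)
  refine ⟨U, U', κ ∘ φ, hκ.comp hφ, hUM, ?_, hJ'⟩
  obtain ⟨T₀, hT₀⟩ := exists_actOn_Ioi_lt (ne_top_of_le_ne_top ENNReal.ofReal_ne_top hUM.le)
    (ENNReal.ofReal_pos.2 hc)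
  by_cases hhigh : ∃ t₁, T₀ ≤ t₁ ∧ 3 * ‖ep - em‖ / 4 ≤ height em ep (U t₁)
  · obtain ⟨t₁, ht₁, hht₁⟩ := hhigh
    refine ⟨-1, max t₁ 0, by linarith [le_max_right t₁ 0],
      fun t ht => hUneg t (by linarith), fun t ht => ?_⟩
    have ht' : t₁ ≤ t := (le_max_left _ _).trans ht
    by_contra! hcon
    have h1 := hcross U U' hUM t₁ t ht' hht₁
      (by change height em ep (U t) < _ at hcon; linarith)
    exact absurd (hT₀ t₁ ht₁)
      (not_lt.2 (h1.trans (actOn_mono Set.Ioc_subset_Ioi_self)))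
  · exfalso
    push Not at hhigh
    have h1 := (hUM.weakTendsto_left_atTop hlsc hcoer hne hzeros hM
      fun t ht => (hhigh t ht).le).height (em := em) (ep := ep)
    rw [height_left] at h1
    obtain ⟨τ, hτ⟩ := eventually_atTop.1 (h1.eventually (gt_mem_nhds
      (show 0 < ‖ep - em‖ / 4 by linarith)))
    refine hQn' fun T => ?_
    set σ : ℝ := max τ 0 + T with hσ
    have h2 := eventually_forall_height_le (em := em) (ep := ep) hM (fun k => hX (φ k)) hlim
      (a := σ - T) (b := σ + T) (show ‖ep - em‖ / 4 < ‖ep - em‖ / 2 by linarith)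
      fun t ht => (hτ t (by linarith [ht.1, le_max_left τ 0])).le
    refine (hκ.comp hφ).tendsto_atTop.frequently (Eventually.frequently ?_)
    filter_upwards [h2] with k hk
    have hT : (0 : ℝ) ≤ T := T.cast_nonneg
    have hσ0 : 0 ≤ σ := by linarith [le_max_right τ 0]
    refine ⟨σ + p (φ k), fun t ht => ?_, ?_⟩
    · have := hk (t - p (φ k)) ⟨by linarith [ht.1], by linarith [ht.2]⟩
      rw [sub_add_cancel] at this
      simp only [Function.comp_apply]
      linarith
    · have h3 := hcross _ _ (h (κ (φ k))) (p (φ k)) (σ + p (φ k)) (by linarith) (hpge _)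
        (hk σ ⟨by linarith, by linarith⟩)
      have h4 : actOn W (V (κ (φ k))) (V' (κ (φ k))) (Set.Iic (s (φ k)) ∪
          Set.Ioc (p (φ k)) (σ + p (φ k))) =
          actOn W (V (κ (φ k))) (V' (κ (φ k))) (Set.Iic (s (φ k))) +
          actOn W (V (κ (φ k))) (V' (κ (φ k))) (Set.Ioc (p (φ k)) (σ + p (φ k))) := by
        refine lintegral_union measurableSet_Ioc (Set.disjoint_left.2 fun t ht ht' => ?_)
        exact absurd (ht'.1.trans_le (Set.mem_Iic.1 ht)) (not_lt.2 (hsp _))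
      have h5 : Set.Iic (s (φ k)) ∪ Set.Ioc (p (φ k)) (σ + p (φ k)) ⊆
          Set.Iic (σ + p (φ k)) := by
        rintro t (ht | ht)
        · exact (Set.mem_Iic.1 ht).trans (by linarith [hsp (φ k)])
        · exact ht.2
      refine le_trans ?_ (actOn_mono h5)
      simp only [Function.comp_apply]
      rw [h4, Nat.cast_add, Nat.cast_one, add_mul, one_mul,
        ENNReal.ofReal_add (by positivity) hc.le]
      exact add_le_add (hsact _) h3

end Extraction

theorem Real.map_volume_mul_left_add {c : ℝ} (hc : 0 < c) (d : ℝ) :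
    Measure.map (fun t : ℝ => c * t + d) volume = ENNReal.ofReal c⁻¹ • volume := by
  have h : (fun t : ℝ => c * t + d) = (fun t => t + d) ∘ fun t => c * t := rfl
  rw [h, ← Measure.map_map (by fun_prop) (by fun_prop), Real.map_volume_mul_left hc.ne',
    Measure.map_smul, map_add_right_eq_self, abs_of_pos (by positivity)]

theorem measurableEmbedding_mul_left_add {c : ℝ} (hc : 0 < c) (d : ℝ) :
    MeasurableEmbedding fun t : ℝ => c * t + d :=
  (measurableEmbedding_addRight d).comp (measurableEmbedding_mulLeft₀ hc.ne')

theorem setLIntegral_Ioi_comp_mul_left_add (f : ℝ → ℝ≥0∞) {c : ℝ} (hc : 0 < c) (a : ℝ) :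
    ∫⁻ t in Set.Ioi a, f (c * t + (a - c * a)) =
      ENNReal.ofReal c⁻¹ * ∫⁻ t in Set.Ioi a, f t := by
  rw [← lintegral_indicator measurableSet_Ioi, ← lintegral_indicator measurableSet_Ioi,
    ← smul_eq_mul (ENNReal.ofReal _), ← lintegral_smul_measure,
    ← Real.map_volume_mul_left_add hc (a - c * a), (measurableEmbedding_mul_left_add hc _).lintegral_map]
  refine lintegral_congr fun t => ?_
  have : a < t ↔ a < c * t + (a - c * a) := by
    rw [← sub_pos, ← sub_pos (b := a), show c * t + (a - c * a) - a = c * (t - a) by ring,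
      mul_pos_iff_of_pos_left hc]
  simp [Set.indicator, this]

section Rescaling

variable {H : Type*} [NormedAddCommGroup H] [InnerProductSpace ℝ H] {em ep : H}
  {W : H → ℝ≥0∞} {M : ℝ} {U U' : ℝ → H}

/-- The curve which follows `U` up to time `a`, and from then on at speed multiplied by `c`. -/
noncomputable def rescaleAfter (a c : ℝ) (U : ℝ → H) (t : ℝ) : H :=
  if t ≤ a then U t else U (c * t + (a - c * a))

/-- The velocity of the curve `rescaleAfter a c U`, in terms of the velocity `U'` of `U`. -/
noncomputable def rescaleAfterDeriv (a c : ℝ) (U' : ℝ → H) : ℝ → H :=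
  (Set.Iic a).piecewise U' fun t => c • U' (c * t + (a - c * a))

theorem rescaleAfter_memA (hA : memA em ep U) (a : ℝ) {c : ℝ} (hc : 0 < c) :
    memA em ep (rescaleAfter a c U) := by
  obtain ⟨tm, tp, -, h1, h2⟩ := hA
  have hs : tp ≤ c * (a + |tp - a| / c) + (a - c * a) := by
    have : c * (a + |tp - a| / c) + (a - c * a) = a + |tp - a| := by field_simp; ring
    linarith [le_abs_self (tp - a)]
  have hp : 0 ≤ |tp - a| / c := by positivity
  refine ⟨min tm a, a + |tp - a| / c + 1, by linarith [min_le_right tm a], fun t ht => ?_,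
    fun t ht => ?_⟩
  · rw [rescaleAfter, if_pos (ht.trans (min_le_right _ _))]
    exact h1 t (ht.trans (min_le_left _ _))
  · rw [rescaleAfter, if_neg (by linarith)]
    exact h2 _ (hs.trans (by nlinarith))

theorem ActionLE.memLp_rescaleAfterDeriv (h : ActionLE W M U U') (a : ℝ) {c : ℝ} (hc : 0 < c) :
    MemLp (rescaleAfterDeriv a c U') 2 volume := by
  refine MemLp.piecewise measurableSet_Iic (h.memLp.restrict _) (MemLp.restrict _ ?_)
  refine MemLp.const_smul ?_ c
  have := (measurableEmbedding_mul_left_add hc (a - c * a)).memLp_map_measure_iff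
    (g := U') (p := 2) (μ := volume)
  rw [Real.map_volume_mul_left_add hc] at this
  exact this.1 (h.memLp.smul_measure ENNReal.ofReal_ne_top)

theorem ActionLE.isH1loc_rescaleAfter (h : ActionLE W M U U') (a : ℝ) {c : ℝ} (hc : 0 < c) :
    IsH1loc (rescaleAfter a c U) (rescaleAfterDeriv a c U') := by
  have hmem := h.memLp_rescaleAfterDeriv a hc
  have hint : ∀ s t, IntervalIntegrable (rescaleAfterDeriv a c U') volume s t := fun s t =>
    ((hmem.locallyIntegrable (by norm_num)).integrableOn_isCompact
      isCompact_uIcc).intervalIntegrable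
  refine ⟨fun s t => ?_, hmem.integrable_norm_pow (by norm_num) |>.locallyIntegrable⟩
  have key : ∀ t, rescaleAfter a c U t - rescaleAfter a c U a =
      ∫ x in a..t, rescaleAfterDeriv a c U' x := by
    intro t
    rcases le_or_gt t a with hta | hta
    · rw [rescaleAfter, rescaleAfter, if_pos hta, if_pos le_rfl, h.ftc]
      refine intervalIntegral.integral_congr fun x hx => ?_
      rw [Set.uIcc_of_ge hta] at hx
      exact (Set.piecewise_eq_of_mem (Set.Iic a) _ _ hx.2).symm
    · rw [rescaleAfter, rescaleAfter, if_neg hta.not_ge, if_pos le_rfl]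
      have h1 : ∫ x in a..t, rescaleAfterDeriv a c U' x =
          ∫ x in a..t, c • U' (c * x + (a - c * a)) := by
        refine intervalIntegral.integral_congr_ae (ae_of_all _ fun x hx => ?_)
        rw [Set.uIoc_of_le hta.le] at hx
        exact Set.piecewise_eq_of_notMem (Set.Iic a) _ _ (not_le.2 hx.1)
      rw [h1, intervalIntegral.integral_smul, intervalIntegral.smul_integral_comp_mul_add,
        ← h.ftc, add_sub_cancel]
  rw [← intervalIntegral.integral_interval_sub_left (hint a t) (hint a s), ← key, ← key]
  abel

/-- The kinetic part of the action over the times after `a`. -/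
noncomputable def kineticAfter (U' : ℝ → H) (a : ℝ) : ℝ≥0∞ :=
  ∫⁻ t in Set.Ioi a, ENNReal.ofReal (‖U' t‖ ^ 2 / 2)

theorem measurable_kinetic (h : ActionLE W M U U') :
    AEMeasurable fun t => ENNReal.ofReal (‖U' t‖ ^ 2 / 2) :=
  ((h.memLp.1.norm.aemeasurable.pow_const 2).div_const 2).ennreal_ofReal

theorem actJ_eq_add (h : ActionLE W M U U') (a : ℝ) :
    actJ W U U' = actOn W U U' (Set.Iic a) +
      (kineticAfter U' a + ∫⁻ t in Set.Ioi a, W (U t)) := by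
  rw [kineticAfter, ← lintegral_add_left' (measurable_kinetic h).restrict, actJ,
    ← lintegral_add_compl _ (measurableSet_Iic (a := a)), Set.compl_Iic, actOn]

theorem actJ_rescaleAfter (h : ActionLE W M U U') (a : ℝ) {c : ℝ} (hc : 0 < c) :
    actJ W (rescaleAfter a c U) (rescaleAfterDeriv a c U') = actOn W U U' (Set.Iic a) +
      (ENNReal.ofReal c * kineticAfter U' a +
        ENNReal.ofReal c⁻¹ * ∫⁻ t in Set.Ioi a, W (U t)) := by
  rw [actJ, ← lintegral_add_compl _ (measurableSet_Iic (a := a)), Set.compl_Iic, actOn]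
  congr 1
  · refine setLIntegral_congr_fun measurableSet_Iic fun t ht => ?_
    simp only [rescaleAfter, rescaleAfterDeriv, Set.piecewise_eq_of_mem _ _ _ ht,
      if_pos (Set.mem_Iic.1 ht)]
  · have h1 : ∀ t ∈ Set.Ioi a, ENNReal.ofReal (‖rescaleAfterDeriv a c U' t‖ ^ 2 / 2) +
        W (rescaleAfter a c U t) =
        (fun t => ENNReal.ofReal (c ^ 2) * ENNReal.ofReal (‖U' t‖ ^ 2 / 2) + W (U t))
          (c * t + (a - c * a)) := by
      intro t ht
      have ht' : ¬ t ≤ a := not_le.2 ht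
      simp only [rescaleAfter, rescaleAfterDeriv, Set.piecewise_eq_of_notMem (Set.Iic a) _ _ ht',
        if_neg ht', norm_smul, mul_pow, Real.norm_eq_abs, sq_abs, mul_div_assoc]
      rw [ENNReal.ofReal_mul (sq_nonneg c)]
    rw [setLIntegral_congr_fun measurableSet_Ioi h1, setLIntegral_Ioi_comp_mul_left_add
        (fun t => ENNReal.ofReal (c ^ 2) * ENNReal.ofReal (‖U' t‖ ^ 2 / 2) + W (U t)) hc,
      lintegral_add_left' ((measurable_kinetic h).restrict.const_mul _),
      lintegral_const_mul' _ _ ENNReal.ofReal_ne_top, mul_add, ← mul_assoc,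
      ← ENNReal.ofReal_mul (by positivity), kineticAfter]
    congr 4
    field_simp

theorem kineticAfter_eq (h : ActionLE W M U U') (hA : memA em ep U)
    (hmin : ∀ V V', IsH1loc V V' → memA em ep V → actJ W U U' ≤ actJ W V V') (a : ℝ) :
    kineticAfter U' a = ∫⁻ t in Set.Ioi a, W (U t) := by
  have hfin : actJ W U U' ≠ ⊤ := ne_top_of_le_ne_top ENNReal.ofReal_ne_top h.le
  have hsum := actJ_eq_add h a
  have hle : ∀ c : ℝ, 0 < c → kineticAfter U' a + ∫⁻ t in Set.Ioi a, W (U t) ≤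
      ENNReal.ofReal c * kineticAfter U' a + ENNReal.ofReal c⁻¹ * ∫⁻ t in Set.Ioi a, W (U t) := by
    intro c hc
    have h1 := hmin _ _ (h.isH1loc_rescaleAfter a hc) (rescaleAfter_memA hA a hc)
    rw [actJ_rescaleAfter h a hc, hsum] at h1
    exact (ENNReal.add_le_add_iff_left
      (ne_top_of_le_ne_top hfin (actOn_le_actJ _))).1 h1
  rw [hsum, ENNReal.add_ne_top, ENNReal.add_ne_top] at hfin
  obtain ⟨-, hK, hP⟩ := hfin
  lift kineticAfter U' a to NNReal using hK with K
  lift ∫⁻ t in Set.Ioi a, W (U t) to NNReal using hP with P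
  have hloc : IsLocalMin (fun c : ℝ => c * K + c⁻¹ * P) 1 := by
    filter_upwards [lt_mem_nhds one_pos] with c hc
    have h1 := hle c hc
    rw [ENNReal.ofReal, ENNReal.ofReal] at h1
    norm_cast at h1
    have h2 := NNReal.coe_le_coe.2 h1
    push_cast [Real.coe_toNNReal _ hc.le, Real.coe_toNNReal _ (inv_nonneg.2 hc.le)] at h2
    simpa using h2
  have hder : HasDerivAt (fun c : ℝ => c * K + c⁻¹ * P) (1 * K + (-((1 : ℝ) ^ 2)⁻¹) * P) 1 :=
    ((hasDerivAt_id 1).mul_const _).add ((hasDerivAt_inv one_ne_zero).mul_const _)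
  have h0 := hloc.hasDerivAt_eq_zero hder
  norm_num at h0
  exact congrArg _ (NNReal.coe_injective (by linarith))

/-- A constrained minimizer satisfies the equipartition relation. -/
theorem equipartition [CompleteSpace H] (hlsc : WeakSeqLSC W) (h : ActionLE W M U U')
    (hA : memA em ep U)
    (hmin : ∀ V V', IsH1loc V V' → memA em ep V → actJ W U U' ≤ actJ W V V') :
    ∀ᵐ t : ℝ, ENNReal.ofReal (‖U' t‖ ^ 2 / 2) = W (U t) := by
  have hfin : actJ W U U' ≠ ⊤ := ne_top_of_le_ne_top ENNReal.ofReal_ne_top h.le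
  have hmW := measurable_potential_comp hlsc h.continuous
  have hK : ∫⁻ t, ENNReal.ofReal (‖U' t‖ ^ 2 / 2) ≠ ⊤ :=
    ne_top_of_le_ne_top hfin (lintegral_mono fun t => le_self_add)
  have hfinK := isFiniteMeasure_withDensity hK
  refine (withDensity_eq_iff (measurable_kinetic h) hmW.aemeasurable hK).1 ?_
  have hIoi : ∀ a, (volume.withDensity fun t => ENNReal.ofReal (‖U' t‖ ^ 2 / 2)) (Set.Ioi a) =
      (volume.withDensity fun t => W (U t)) (Set.Ioi a) := fun a => by
    rw [withDensity_apply _ measurableSet_Ioi, withDensity_apply _ measurableSet_Ioi]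
    exact kineticAfter_eq h hA hmin a
  refine Measure.ext_of_Ioc _ _ fun a b hab => ?_
  have hd : Set.Ioc a b = Set.Ioi a \ Set.Ioi b := Set.Ioi_sdiff_Ioi.symm
  have hsub : Set.Ioi b ⊆ Set.Ioi a := Set.Ioi_subset_Ioi hab.le
  rw [hd, measure_sdiff hsub measurableSet_Ioi.nullMeasurableSet (measure_ne_top _ _),
    measure_sdiff hsub measurableSet_Ioi.nullMeasurableSet
      (by rw [← hIoi]; exact measure_ne_top _ _),
    hIoi, hIoi]

end Rescaling

/-- Existence of a minimal heteroclinic orbit in a Hilbert space, together with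
weak convergence at `±∞` and the equipartition relation. -/
theorem stmt_0 {H : Type*} [NormedAddCommGroup H] [InnerProductSpace ℝ H]
    [CompleteSpace H]
    (W : H → ℝ≥0∞) (em ep : H)
    -- `𝒲` is weakly sequentially lower semicontinuous
    (hlsc : ∀ (v : ℕ → H) (w : H),
      (∀ f : H, Tendsto (fun k => ⟪f, v k⟫) atTop (nhds ⟪f, w⟫)) →
      W w ≤ liminf (fun k => W (v k)) atTop)
    -- `𝒲` has exactly two zeros `e⁻` and `e⁺`
    (hne : em ≠ ep)
    (hzeros : ∀ v, W v = 0 ↔ v = em ∨ v = ep)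
    -- `liminf_{‖v‖→∞} 𝒲(v) > 0`
    (hcoer : ∃ ε : ℝ≥0∞, 0 < ε ∧ ∃ R : ℝ, ∀ v : H, R ≤ ‖v‖ → ε ≤ W v)
    -- the infimum of `𝒥` over `𝒜` is finite
    (hfin : ∃ V V', IsH1loc V V' ∧ memA em ep V ∧ actJ W V V' < ⊤) :
    ∃ U U', IsH1loc U U' ∧ memA em ep U ∧
      (∀ V V', IsH1loc V V' → memA em ep V → actJ W U U' ≤ actJ W V V') ∧
      (∀ f : H, Tendsto (fun t => ⟪f, U t⟫) atTop (nhds ⟪f, ep⟫)) ∧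
      (∀ f : H, Tendsto (fun t => ⟪f, U t⟫) atBot (nhds ⟪f, em⟫)) ∧
      (∀ᵐ t : ℝ, ENNReal.ofReal (‖U' t‖ ^ 2 / 2) = W (U t)) := by
  have hlsc' : WeakSeqLSC W := hlsc
  have hcoer' : PosAtInfinity W := hcoer
  let S : Set ℝ≥0∞ := {x | ∃ V V', IsH1loc V V' ∧ memA em ep V ∧ x = actJ W V V'}
  obtain ⟨V₀, V₀', h₀, hA₀, hJ₀⟩ := hfin
  have hS₀ : actJ W V₀ V₀' ∈ S := ⟨V₀, V₀', h₀, hA₀, rfl⟩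
  have hm : sInf S ≠ ⊤ := ((sInf_le hS₀).trans_lt hJ₀).ne
  obtain ⟨x, -, hx, hxS⟩ := exists_seq_tendsto_sInf ⟨_, hS₀⟩ (OrderBot.bddBelow S)
  set M : ℝ := (sInf S + 1).toReal
  have hM : ENNReal.ofReal M = sInf S + 1 :=
    ENNReal.ofReal_toReal (ENNReal.add_ne_top.2 ⟨hm, ENNReal.one_ne_top⟩)
  have hlt : sInf S < ENNReal.ofReal M := hM ▸ ENNReal.lt_add_right hm one_ne_zero
  obtain ⟨N, hN⟩ := eventually_atTop.1 (hx.eventually (gt_mem_nhds hlt))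
  choose V V' hV hA hxV using hxS
  have hact : ∀ k, ActionLE W M (V (k + N)) (V' (k + N)) := fun k =>
    (hV _).actionLE hne hzeros (hA _) (hxV (k + N) ▸ (hN _ (Nat.le_add_left _ _)).le)
  obtain ⟨U, U', φ, hφ, hU, hUA, hUJ⟩ := exists_constrained_limit hlsc' hcoer' hne hzeros
    ENNReal.toReal_nonneg hact fun k => hA _
  have hlim : Tendsto (fun k => actJ W (V (φ k + N)) (V' (φ k + N))) atTop (nhds (sInf S)) := by
    simp only [← hxV]
    exact (hx.comp (tendsto_add_atTop_nat N)).comp hφ.tendsto_atTop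
  rw [hlim.liminf_eq] at hUJ
  have hmin : ∀ V V', IsH1loc V V' → memA em ep V → actJ W U U' ≤ actJ W V V' :=
    fun V V' hV hA => hUJ.trans (sInf_le ⟨V, V', hV, hA, rfl⟩)
  obtain ⟨tm, tp, -, htm, htp⟩ := id hUA
  exact ⟨U, U', hU.isH1loc, hUA, hmin,
    hU.weakTendsto_right_atTop hlsc' hcoer' hne hzeros ENNReal.toReal_nonneg htp,
    hU.weakTendsto_left_atBot hlsc' hcoer' hne hzeros ENNReal.toReal_nonneg htm,
    equipartition hlsc' hU hUA hmin⟩
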